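/- Let Z be a Noetherian scheme and let X, Y, Y' be schemes proper over Z. Let f : X → Y and f' : X → Y' be morphisms of schemes over Z. Suppose that for every irreducible closed subset C ⊆ X of Krull dimension one such that f(C) is a single point, the image f'(C) is also a single point. Then for every point y ∈ Y and every connected component W of the topological fiber f⁻¹(y), the image f'(W) is a single point. -/

import Mathlib

/-!
Let `Z` be a Noetherian scheme and let `X`, `Y`, `Y'` be schemes proper over `Z`.
Let `f : X → Y` and `f' : X → Y'` be morphisms of schemes over `Z`.
Suppose that for every irreducible closed subset `C ⊆ X` of Krull dimension one such that
`f(C)` is a single point, the image `f'(C)` is also a single point.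
Then for every point `y ∈ Y` and every connected component `W` of the topological fiber
`f⁻¹(y)`, the image `f'(W)` is a single point.
-/

open CategoryTheory AlgebraicGeometry

universe u

theorem cnf_no_chain {R : Type*} [CommRing R] [IsDomain R] (a b : Ideal R)
    [a.IsPrime] [b.IsPrime] (ha : a ≠ ⊥) (hab : a < b) (hb : b.height ≤ 1) : False := by
  have h1 := Ideal.height_add_one_le_of_lt_of_isPrime hab
  have h2 := Ideal.height_add_one_le_of_lt_of_isPrime (bot_lt_iff_ne_bot.mpr ha)
  have h3 : (⊥ : Ideal R).height + 1 + 1 ≤ 1 := (add_le_add_left h2 1).trans (h1.trans hb)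
  have h4 : (1 : ℕ∞) + 1 ≤ 1 := le_trans (by gcongr; exact le_add_self) h3
  exact absurd h4 (by decide)

theorem cnf_dom {R : Type*} [CommRing R] [IsDomain R] [IsNoetherianRing R]
    (a b : Ideal R) [a.IsPrime] [b.IsPrime] (ha : a ≠ ⊥) (hab : a < b)
    (s : R) (hs : s ≠ 0) : ∃ P : Ideal R, P.IsPrime ∧ P ≠ ⊥ ∧ P ≤ b ∧ s ∉ P := by
  classical
  by_cases hsb : s ∈ b
  swap
  · exact ⟨b, inferInstance, (bot_le.trans_lt hab).ne', le_rfl, hsb⟩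
  have hfin := Ideal.finite_minimalPrimes_of_isNoetherianRing R (Ideal.span {s})
  have hnot : ¬ ((b : Set R) ⊆ ⋃ i ∈ (↑hfin.toFinset : Set (Ideal R)), (i : Set R)) := by
    rw [Ideal.subset_union_prime (f := fun i => i) ⊥ ⊥]
    · rintro ⟨Q, hQ, hbQ⟩
      rw [Set.Finite.mem_toFinset] at hQ
      have := hQ.1.1
      exact cnf_no_chain a Q ha (hab.trans_le hbQ)
        (Ideal.height_le_one_of_isPrincipal_of_mem_minimalPrimes (Ideal.span {s}) Q hQ)
    · intro i hi _ _
      rw [Set.Finite.mem_toFinset] at hi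
      exact hi.1.1
  obtain ⟨x, hxb, hx⟩ := Set.not_subset.mp hnot
  have hx' : ∀ Q ∈ (Ideal.span {s}).minimalPrimes, x ∉ Q := by
    intro Q hQ hxQ
    apply hx
    simp only [Set.mem_iUnion]
    exact ⟨Q, by simpa using hQ, hxQ⟩
  obtain ⟨P, hP, hPb⟩ := Ideal.exists_minimalPrimes_le (I := Ideal.span {x}) (J := b)
    ((Ideal.span_singleton_le_iff_mem _).mpr hxb)
  have hPp := hP.1.1
  have hxP : x ∈ P := (Ideal.span_singleton_le_iff_mem _).mp hP.1.2
  refine ⟨P, hPp, ?_, hPb, ?_⟩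
  · rintro rfl
    obtain ⟨Q, hQ, -⟩ := Ideal.exists_minimalPrimes_le (I := Ideal.span {s}) (J := b)
      ((Ideal.span_singleton_le_iff_mem _).mpr hsb)
    apply hx' Q hQ
    rw [(Ideal.mem_bot).mp hxP]; exact Q.zero_mem
  · intro hsP
    obtain ⟨Q, hQ, hQP⟩ := Ideal.exists_minimalPrimes_le (I := Ideal.span {s}) (J := P)
      ((Ideal.span_singleton_le_iff_mem _).mpr hsP)
    have := hQ.1.1
    refine cnf_no_chain Q P ?_ (lt_of_le_of_ne hQP ?_)
      (Ideal.height_le_one_of_isPrincipal_of_mem_minimalPrimes (Ideal.span {x}) P hP)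
    · rintro rfl
      exact hs (by simpa using (Ideal.span_singleton_le_iff_mem _).mp hQ.1.2)
    · rintro rfl
      exact hx' _ hQ hxP

theorem cnf_ring {R : Type*} [CommRing R] [IsNoetherianRing R]
    (q a b : Ideal R) [q.IsPrime] [a.IsPrime] [b.IsPrime] (ha : q < a) (hab : a < b)
    (s : R) (hs : s ∉ q) : ∃ P : Ideal R, P.IsPrime ∧ q < P ∧ P ≤ b ∧ s ∉ P := by
  let π := Ideal.Quotient.mk q
  have hπ : Function.Surjective π := Ideal.Quotient.mk_surjective
  have hk : RingHom.ker π = q := Ideal.mk_ker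
  have h1 : (a.map π).IsPrime := Ideal.map_isPrime_of_surjective hπ (hk.trans_le ha.le)
  have h2 : (b.map π).IsPrime := Ideal.map_isPrime_of_surjective hπ (hk.trans_le (ha.trans hab).le)
  have ca : (a.map π).comap π = a := by
    rw [Ideal.comap_map_of_surjective' π hπ, hk, sup_eq_left.mpr ha.le]
  have cb : (b.map π).comap π = b := by
    rw [Ideal.comap_map_of_surjective' π hπ, hk, sup_eq_left.mpr (ha.trans hab).le]
  have cbot : (⊥ : Ideal (R ⧸ q)).comap π = q := hk
  obtain ⟨P, hP, hP0, hPb, hsP⟩ := cnf_dom (a.map π) (b.map π)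
    (fun h => by rw [h, cbot] at ca; exact ha.ne ca)
    (lt_of_le_of_ne (Ideal.map_mono hab.le) (fun h => by
      rw [h, cb] at ca; exact hab.ne' ca)) (π s)
    (fun h => hs (Ideal.Quotient.eq_zero_iff_mem.mp h))
  refine ⟨P.comap π, inferInstance, lt_of_le_of_ne ?_ ?_, ?_, hsP⟩
  · exact cbot.symm.le.trans (Ideal.comap_mono bot_le)
  · intro h
    apply hP0
    apply Ideal.comap_injective_of_surjective π hπ
    rw [← h, cbot]
  · rw [← cb]; exact Ideal.comap_mono hPb

theorem cnf_scheme (X : Scheme.{u}) [IsLocallyNoetherian X] (η q p : X)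
    (h1 : η ⤳ q) (h2 : q ⤳ p) (n1 : η ≠ q) (n2 : q ≠ p) (D : Set X) (hD : IsClosed D)
    (hη : η ∉ D) : ∃ P : X, η ⤳ P ∧ P ⤳ p ∧ P ≠ η ∧ P ∉ D := by
  have hr := Scheme.range_fromSpecStalk (X := X) (x := p)
  obtain ⟨η', rfl⟩ : η ∈ Set.range (X.fromSpecStalk p) := by rw [hr]; exact h1.trans h2
  obtain ⟨q', rfl⟩ : q ∈ Set.range (X.fromSpecStalk p) := by rw [hr]; exact h2
  obtain ⟨p', hp'⟩ : p ∈ Set.range (X.fromSpecStalk p) := by rw [hr]; exact specializes_rfl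
  have emb := (X.fromSpecStalk p).isEmbedding
  have s1 : η' ⤳ q' := emb.toIsInducing.specializes_iff.mp h1
  have s2 : q' ⤳ p' := emb.toIsInducing.specializes_iff.mp (hp'.symm ▸ h2)
  have lt1 : η'.asIdeal < q'.asIdeal := lt_of_le_of_ne
    ((PrimeSpectrum.le_iff_specializes η' q').mpr s1)
    (fun h => n1 (by rw [PrimeSpectrum.ext h]))
  have lt2 : q'.asIdeal < p'.asIdeal := lt_of_le_of_ne
    ((PrimeSpectrum.le_iff_specializes q' p').mpr s2)
    (fun h => n2 (by rw [PrimeSpectrum.ext h, hp']))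
  have hD' : IsClosed ((X.fromSpecStalk p) ⁻¹' D) := hD.preimage emb.continuous
  obtain ⟨I, hI⟩ := (PrimeSpectrum.isClosed_iff_zeroLocus_ideal _).mp hD'
  have hη' : η' ∉ PrimeSpectrum.zeroLocus (I : Set (X.presheaf.stalk p)) := by
    rw [← hI]; exact hη
  obtain ⟨s, hsI, hs⟩ := Set.not_subset.mp (fun h => hη' h)
  have := η'.2
  have := q'.2
  have := p'.2
  obtain ⟨P, hP, hlt, hle, hsP⟩ := cnf_ring η'.asIdeal q'.asIdeal p'.asIdeal lt1 lt2 s hs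
  let P' : PrimeSpectrum (X.presheaf.stalk p) := ⟨P, hP⟩
  refine ⟨X.fromSpecStalk p P', ?_, ?_, ?_, ?_⟩
  · exact emb.toIsInducing.specializes_iff.mpr
      ((PrimeSpectrum.le_iff_specializes η' P').mp hlt.le)
  · have : X.fromSpecStalk p P' ∈ Set.range (X.fromSpecStalk p) := ⟨_, rfl⟩
    rw [hr] at this; exact this
  · intro h
    have := emb.injective h
    exact hlt.ne (congrArg PrimeSpectrum.asIdeal this).symm
  · intro h
    have : P' ∈ PrimeSpectrum.zeroLocus (I : Set (X.presheaf.stalk p)) := by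
      rw [← hI]; exact h
    exact hsP (this hsI)

theorem cnf_dim {X : Type*} [TopologicalSpace X] [T0Space X] [QuasiSober X] (η r : X)
    (hr : η ⤳ r) (hne : η ≠ r)
    (h : ∀ q p : X, η ⤳ q → q ⤳ p → η ≠ q → q = p) :
    topologicalKrullDim (closure ({η} : Set X)) = 1 := by
  have hq : QuasiSober (closure ({η} : Set X)) :=
    isClosed_closure.isClosedEmbedding_subtypeVal.quasiSober
  unfold topologicalKrullDim
  let _ := specializationOrder (closure ({η} : Set X))
  rw [Order.krullDim_eq_of_orderIso (irreducibleSetEquivPoints (α := closure ({η} : Set X)))]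
  have key : ∀ a b : closure ({η} : Set X), a ≤ b ↔ b.1 ⤳ a.1 := fun a b =>
    subtype_specializes_iff b a
  apply le_antisymm
  · rw [Order.krullDim_le_one_iff]
    intro x
    by_cases hx : η = x.1
    · right
      intro b _
      rw [key, ← hx, specializes_iff_mem_closure]
      exact b.2
    · left
      intro b hb
      rw [key] at hb ⊢
      have := h x.1 b.1 (specializes_iff_mem_closure.mpr x.2) hb hx
      rw [this]
  · rw [WithBot.one_le_iff_pos, Order.krullDim_pos_iff]
    refine ⟨⟨r, specializes_iff_mem_closure.mp hr⟩, ⟨η, subset_closure rfl⟩, ?_⟩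
    refine lt_of_le_of_ne ((key _ _).mpr hr) ?_
    intro h
    exact hne (congrArg Subtype.val h).symm

theorem cnf_irred (X Y Y' : Scheme.{u}) [AlgebraicGeometry.IsNoetherian X]
    (f : X ⟶ Y) (f' : X ⟶ Y') (hcl : IsClosedMap f')
    (hcurves : ∀ C : Set X, IsIrreducible C → IsClosed C →
      topologicalKrullDim C = 1 →
      (∃ y : Y, f '' C = {y}) → (∃ y' : Y', f' '' C = {y'})) (η : X) :
    (∀ x, η ⤳ x → f x = f η) → ∀ x, η ⤳ x → f' x = f' η := by
  have wf : WellFounded (fun a b : X => (⟨closure {a}, isClosed_closure⟩ :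
      TopologicalSpace.Closeds X) < ⟨closure {b}, isClosed_closure⟩) :=
    InvImage.wf _ (wellFounded_lt (α := TopologicalSpace.Closeds X))
  induction η using wf.induction with
  | _ η ih =>
  intro hη
  have ih' : ∀ q, η ⤳ q → η ≠ q → ∀ x, q ⤳ x → f' x = f' q := by
    intro q hq hne
    refine ih q ?_ ?_
    · refine lt_of_le_of_ne hq.closure_subset ?_
      intro h
      have : closure {q} = closure {η} := congrArg TopologicalSpace.Closeds.carrier h
      have h2 : q ⤳ η := by
        rw [specializes_iff_mem_closure, this]; exact subset_closure rfl
      exact hne (hq.antisymm h2).eq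
    · intro x hx
      rw [hη x (hq.trans hx), hη q hq]
  by_cases hch : ∃ q p : X, η ⤳ q ∧ q ⤳ p ∧ η ≠ q ∧ q ≠ p
  · obtain ⟨q, p₀, h1, h2₀, n1, n2₀⟩ := hch
    obtain ⟨p, hp, hpc⟩ := (isClosed_closure (s := ({p₀} : Set X))).exists_closed_singleton
      ⟨p₀, subset_closure rfl⟩
    have h2₁ : p₀ ⤳ p := specializes_iff_mem_closure.mpr hp
    have h2 : q ⤳ p := h2₀.trans h2₁
    have n2 : q ≠ p := by
      rintro rfl
      exact n2₀ (h2₀.antisymm h2₁).eq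
    have hc : IsClosed ({f' p} : Set Y') := by
      have := hcl _ hpc
      rwa [Set.image_singleton] at this
    have hmem : η ∈ f' ⁻¹' {f' p} := by
      by_contra hcon
      obtain ⟨P, hP1, hP2, hP3, hP4⟩ := cnf_scheme X η q p h1 h2 n1 n2 (f' ⁻¹' {f' p})
        (hc.preimage f'.continuous) hcon
      exact hP4 (ih' P hP1 hP3.symm p hP2).symm
    intro x hx
    have h3 : f' η = f' p := hmem
    have h4 : f' η ⤳ f' x := hx.map f'.continuous
    rw [h3] at h4 ⊢
    have := h4.mem_closed hc rfl
    exact this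
  · by_cases hr : ∃ r, η ⤳ r ∧ η ≠ r
    · obtain ⟨r, hr, hne⟩ := hr
      have hd := cnf_dim η r hr hne (fun q p a b c => by
        by_contra hcon
        exact hch ⟨q, p, a, b, c, hcon⟩)
      obtain ⟨y', hy'⟩ := hcurves _ isIrreducible_singleton.closure isClosed_closure hd
        ⟨f η, by
          ext t
          constructor
          · rintro ⟨x, hx, rfl⟩
            exact hη x (specializes_iff_mem_closure.mpr hx)
          · rintro rfl
            exact ⟨η, subset_closure rfl, rfl⟩⟩
      have hall : ∀ x, η ⤳ x → f' x = y' := fun x hx => by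
        have : f' x ∈ f' '' closure {η} := ⟨x, specializes_iff_mem_closure.mp hx, rfl⟩
        rw [hy'] at this; exact this
      intro x hx
      rw [hall x hx, hall η specializes_rfl]
    · intro x hx
      by_cases h : η = x
      · rw [h]
      · exact absurd ⟨x, hx, h⟩ hr

theorem cnf_fin (Z Y Y' : Scheme.{u}) (pY : Y ⟶ Z) (pY' : Y' ⟶ Z) [IsProper pY']
    (y : Y) (t : Y') (ht : IsClosed ({t} : Set Y')) :
    {w : ↥(Limits.pullback pY pY') | Limits.pullback.fst pY pY' w = y ∧ Limits.pullback.snd pY pY' w = t}.Finite := by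
  let j := Y'.fromSpecResidueField t
  have hj : IsClosedImmersion j := .of_isPreimmersion _ (by
    rw [Scheme.range_fromSpecResidueField]; exact ht)
  have hq : LocallyQuasiFinite (j ≫ pY') := .of_injective (fun a b _ => Subsingleton.elim a b)
  have hqc : QuasiCompact (j ≫ pY') := inferInstance
  let s := Limits.pullback.snd pY pY'
  let g := s.fiberι t ≫ Limits.pullback.fst pY pY'
  have hpb : IsPullback (Limits.pullback.snd s j) (Limits.pullback.fst s j ≫ Limits.pullback.fst pY pY') (j ≫ pY') pY := by
    have h1 : IsPullback (Limits.pullback.fst s j) (Limits.pullback.snd s j) s j := IsPullback.of_hasPullback s j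
    have h2 : IsPullback (Limits.pullback.fst pY pY') s pY pY' := IsPullback.of_hasPullback pY pY'
    exact (h1.paste_horiz h2.flip.flip.flip.flip).flip
  have hg : LocallyQuasiFinite g := MorphismProperty.of_isPullback hpb hq
  have hg' : QuasiCompact g := MorphismProperty.of_isPullback hpb hqc
  refine ((g.finite_preimage_singleton y).image (s.fiberι t)).subset ?_
  rintro w ⟨hw1, hw2⟩
  have : w ∈ Set.range (s.fiberι t) := by rw [Scheme.Hom.range_fiberι]; exact hw2
  obtain ⟨v, rfl⟩ := this
  exact ⟨v, by simpa [g] using hw1, rfl⟩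

theorem cnf_discrete {T Y : Scheme.{u}} (g : T ⟶ Y) (U : Y.Opens) [IsFinite (g ∣_ U)]
    (y : Y) (hy : y ∈ U) : _root_.IsDiscrete (g ⁻¹' {y}) := by
  have h := ((g ∣_ U).isDiscrete_preimage_singleton ⟨y, hy⟩).image
    ((g ⁻¹ᵁ U).ι).isOpenEmbedding.toIsInducing
  refine h.mono ?_
  intro x hx
  have hx' : g x = y := hx
  refine ⟨⟨x, by show g x ∈ U; rwa [hx']⟩, ?_, rfl⟩
  apply Subtype.ext
  exact (morphismRestrict_base_coe g U _).trans hx'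

theorem contracts_nonclosed_fibers
    (Z X Y Y' : Scheme.{u}) [AlgebraicGeometry.IsNoetherian Z]
    (pX : X ⟶ Z) (pY : Y ⟶ Z) (pY' : Y' ⟶ Z)
    [IsProper pX] [IsProper pY] [IsProper pY']
    (f : X ⟶ Y) (f' : X ⟶ Y')
    (hf : f ≫ pY = pX) (hf' : f' ≫ pY' = pX)
    (hcurves : ∀ C : Set X, IsIrreducible C → IsClosed C →
      topologicalKrullDim C = 1 →
      (∃ y : Y, f.base '' C = {y}) → (∃ y' : Y', f'.base '' C = {y'})) :
    ∀ (y : Y) (x : X), f.base x = y →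
      ∃ y' : Y', f'.base '' connectedComponentIn (f.base ⁻¹' {y}) x = {y'} := by
  subst hf
  have _ : IsLocallyNoetherian X := LocallyOfFiniteType.isLocallyNoetherian (f ≫ pY)
  have _ : CompactSpace X := QuasiCompact.compactSpace_of_compactSpace (f ≫ pY)
  have _ : CompactSpace Y := QuasiCompact.compactSpace_of_compactSpace pY
  have _ : AlgebraicGeometry.IsNoetherian X := {}
  have _ : IsProper f := .of_comp f pY
  have _ : IsProper (f' ≫ pY') := by rw [hf']; infer_instance
  have _ : IsProper f' := .of_comp f' pY'
  have hcl' : IsClosedMap f' := f'.isClosedMap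
  have hI := cnf_irred X Y Y' f f' hcl' hcurves
  let h : X ⟶ Limits.pullback pY pY' := Limits.pullback.lift f f' hf'.symm
  have hfst : h ≫ Limits.pullback.fst pY pY' = f := Limits.pullback.lift_fst _ _ _
  have hsnd : h ≫ Limits.pullback.snd pY pY' = f' := Limits.pullback.lift_snd _ _ _
  have _ : IsProper (h ≫ Limits.pullback.fst pY pY') := by rw [hfst]; infer_instance
  rintro y x rfl
  obtain ⟨y₀, hy₀, hy₀c⟩ := (isClosed_closure (s := ({f x} : Set Y))).exists_closed_singleton
      ⟨f x, subset_closure rfl⟩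
  have hfin : (h '' ((h ≫ Limits.pullback.fst pY pY') ⁻¹' {y₀})).Finite := by
    rw [hfst]
    obtain ⟨S, hSf, hSc, hSi, hSU⟩ :=
      TopologicalSpace.NoetherianSpace.exists_finite_set_isClosed_irreducible
        (hy₀c.preimage f.continuous)
    rw [hSU, Set.image_sUnion]
    refine Set.Finite.sUnion (hSf.image _) ?_
    rintro _ ⟨V, hV, rfl⟩
    obtain ⟨η, hη⟩ := QuasiSober.sober (hSi V hV) (hSc V hV)
    have hspec : ∀ v ∈ V, η ⤳ v := fun v hv => by
      rw [specializes_iff_mem_closure, hη.def]; exact hv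
    have hmem : ∀ v, η ⤳ v → v ∈ V := fun v hv => by
      rw [← hη.def]; exact specializes_iff_mem_closure.mp hv
    have hVf : ∀ v ∈ V, f v = y₀ := fun v hv => by
      have : v ∈ f ⁻¹' {y₀} := by rw [hSU]; exact ⟨V, hV, hv⟩
      exact this
    have hVf' := hI η (fun v hv => by
      rw [hVf v (hmem v hv), hVf η (hmem η specializes_rfl)])
    have ht : IsClosed ({f' η} : Set Y') := by
      have h1 : f' '' V = {f' η} := by
        ext t
        constructor
        · rintro ⟨v, hv, rfl⟩
          exact hVf' v (hspec v hv)
        · rintro rfl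
          exact ⟨η, hmem η specializes_rfl, rfl⟩
      rw [← h1]
      exact hcl' _ (hSc V hV)
    refine (cnf_fin Z Y Y' pY pY' y₀ (f' η) ht).subset ?_
    rintro _ ⟨v, hv, rfl⟩
    refine ⟨?_, ?_⟩
    · rw [← Scheme.Hom.comp_apply, hfst]; exact hVf v hv
    · rw [← Scheme.Hom.comp_apply, hsnd]; exact hVf' v (hspec v hv)
  obtain ⟨U, hyU, hUfin⟩ :=
    exists_finite_imageι_comp_morphismRestrict_of_finite_image_preimage h
      (Limits.pullback.fst pY pY') y₀ hfin
  have hyU' : f x ∈ U := (specializes_iff_mem_closure.mpr hy₀).mem_open U.isOpen hyU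
  have hdisc := cnf_discrete (h.imageι ≫ Limits.pullback.fst pY pY') U (f x) hyU'
  have hxm : x ∈ connectedComponentIn (f ⁻¹' {f x}) x := mem_connectedComponentIn rfl
  have hpre : _root_.IsPreconnected (h.toImage '' connectedComponentIn (f ⁻¹' {f x}) x) :=
    isPreconnected_connectedComponentIn.image _ h.toImage.continuous.continuousOn
  have hsub : h.toImage '' connectedComponentIn (f ⁻¹' {f x}) x ⊆
      (h.imageι ≫ Limits.pullback.fst pY pY') ⁻¹' {f x} := by
    rintro _ ⟨w, hw, rfl⟩
    have hw' : w ∈ f ⁻¹' {f x} := connectedComponentIn_subset _ _ hw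
    have hw' : f w = f x := hw'
    show (h.imageι ≫ Limits.pullback.fst pY pY') (h.toImage w) = f x
    rw [← Scheme.Hom.comp_apply, Scheme.Hom.toImage_imageι_assoc, hfst, hw']
  have hss : (h.toImage '' connectedComponentIn (f ⁻¹' {f x}) x).Subsingleton := by
    have hd := hdisc.mono hsub
    have := hd.1
    have := isPreconnected_iff_preconnectedSpace.mp hpre
    rw [← Set.subsingleton_coe]
    exact PreconnectedSpace.trivial_of_discrete
  have hfac : ∀ w, f' w = (h.imageι ≫ Limits.pullback.snd pY pY') (h.toImage w) := fun w => by
    rw [← Scheme.Hom.comp_apply, Scheme.Hom.toImage_imageι_assoc, hsnd]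
  refine ⟨f' x, ?_⟩
  ext t
  constructor
  · rintro ⟨w, hw, rfl⟩
    show f' w = f' x
    rw [hfac w, hfac x, hss ⟨w, hw, rfl⟩ ⟨x, hxm, rfl⟩]
  · rintro rfl
    exact ⟨x, hxm, rfl⟩
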